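/- Let p and q be continuously differentiable, strictly positive probability densities on ℝⁿ with finite Fisher information, and let λ ∈ (0,1). Then equality J(λp + (1-λ)q) = λ J(p) + (1-λ) J(q) holds if and only if p(x) = q(x) for all x ∈ ℝⁿ. -/

import Mathlib

open MeasureTheory Real

lemma continuous_gradient_of_contDiff_one {E : Type*} [NormedAddCommGroup E]
    [InnerProductSpace ℝ E] [CompleteSpace E] {f : E → ℝ} (hf : ContDiff ℝ 1 f) :
    Continuous (gradient f) :=
  (InnerProductSpace.toDual ℝ E).symm.continuous.comp (hf.continuous_fderiv one_ne_zero)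

lemma gradient_const_mul_add_const_mul {E : Type*} [NormedAddCommGroup E]
    [InnerProductSpace ℝ E] [CompleteSpace E] {f g : E → ℝ} {x : E}
    (hf : DifferentiableAt ℝ f x) (hg : DifferentiableAt ℝ g x) (a b : ℝ) :
    gradient (fun y => a * f y + b * g y) x = a • gradient f x + b • gradient g x := by
  refine HasGradientAt.gradient ?_
  rw [hasGradientAt_iff_hasFDerivAt]
  have h := (hf.hasFDerivAt.const_mul a).add (hg.hasFDerivAt.const_mul b)
  rw [map_add, map_smul, map_smul, toDual_gradient, toDual_gradient]
  exact h

/-- The defect in the joint convexity of `(v, t) ↦ ‖v‖ ^ 2 / t` is an explicit square. -/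
lemma norm_sq_div_convexity_defect {E : Type*} [NormedAddCommGroup E]
    [InnerProductSpace ℝ E] (u v : E) {a b s t : ℝ} (ha : 0 < a) (hb : 0 < b)
    (hs : 0 < s) (ht : 0 < t) :
    a * (‖u‖ ^ 2 / s) + b * (‖v‖ ^ 2 / t) - ‖a • u + b • v‖ ^ 2 / (a * s + b * t)
      = a * b / (s * t * (a * s + b * t)) * ‖t • u - s • v‖ ^ 2 := by
  have h : 0 < a * s + b * t := by positivity
  rw [norm_add_sq_real, norm_sub_sq_real]
  simp only [norm_smul, inner_smul_left, inner_smul_right, Real.norm_eq_abs, mul_pow, sq_abs,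
    conj_trivial]
  field_simp
  ring

/-- Functions with equal logarithmic gradients are proportional if the second one vanishes nowhere. -/
lemma exists_eq_const_mul_of_smul_gradient_eq {E : Type*} [NormedAddCommGroup E]
    [InnerProductSpace ℝ E] [CompleteSpace E] {p q : E → ℝ}
    (hp : Differentiable ℝ p) (hq : Differentiable ℝ q) (hq0 : ∀ x, q x ≠ 0)
    (h : ∀ x, q x • gradient p x = p x • gradient q x) :
    ∃ c : ℝ, ∀ x, p x = c * q x := by
  have hx : ∀ x, q x • fderiv ℝ p x = p x • fderiv ℝ q x := fun x => by
    simpa [toDual_gradient] using congrArg (InnerProductSpace.toDual ℝ E) (h x)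
  have hder : ∀ x, HasFDerivAt (fun y => p y * (q y)⁻¹) (0 : E →L[ℝ] ℝ) x := by
    intro x
    have hinv := (hasDerivAt_inv (hq0 x)).comp_hasFDerivAt x (hq x).hasFDerivAt
    refine ((hp x).hasFDerivAt.mul hinv).congr_fderiv (ContinuousLinearMap.ext fun v => ?_)
    have hv : q x * fderiv ℝ p x v = p x * fderiv ℝ q x v := by
      simpa using congrArg (fun L : E →L[ℝ] ℝ => L v) (hx x)
    have := hq0 x
    simp only [Function.comp_apply, add_apply, smul_apply, zero_apply, smul_eq_mul]
    field_simp
    linear_combination hv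
  refine ⟨p 0 * (q 0)⁻¹, fun x => ?_⟩
  rw [← is_const_of_fderiv_eq_zero (fun x => (hder x).differentiableAt)
    (fun x => (hder x).fderiv) x 0, inv_mul_cancel_right₀ (hq0 x)]

/-- Equality case of convexity of Fisher information
`J(p) = ∫ ‖∇p(x)‖²/p(x) dx`: for continuously differentiable strictly positive
probability densities `p, q` on `ℝⁿ` with finite Fisher information and `λ ∈ (0,1)`,
`J(λp + (1-λ)q) = λ J(p) + (1-λ) J(q)` holds if and only if `p = q` everywhere. -/
theorem fisher_information_convex_eq_iff
    (n : ℕ) (p q : EuclideanSpace ℝ (Fin n) → ℝ)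
    (hp : ContDiff ℝ 1 p) (hq : ContDiff ℝ 1 q)
    (hppos : ∀ x, 0 < p x) (hqpos : ∀ x, 0 < q x)
    (hpint : (∫ x, p x) = 1) (hqint : (∫ x, q x) = 1)
    (hJp : Integrable (fun x => ‖gradient p x‖ ^ 2 / p x))
    (hJq : Integrable (fun x => ‖gradient q x‖ ^ 2 / q x))
    (lam : ℝ) (hlam : lam ∈ Set.Ioo (0 : ℝ) 1) :
    ((∫ x, ‖gradient (fun y => lam * p y + (1 - lam) * q y) x‖ ^ 2
        / (lam * p x + (1 - lam) * q x))
      = lam * (∫ x, ‖gradient p x‖ ^ 2 / p x)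
        + (1 - lam) * ∫ x, ‖gradient q x‖ ^ 2 / q x)
    ↔ ∀ x, p x = q x := by
  obtain ⟨hl0, hl1⟩ := hlam
  have hm0 : 0 < 1 - lam := sub_pos.mpr hl1
  have hpd : Differentiable ℝ p := hp.differentiable one_ne_zero
  have hqd : Differentiable ℝ q := hq.differentiable one_ne_zero
  have hgp := continuous_gradient_of_contDiff_one hp
  have hgq := continuous_gradient_of_contDiff_one hq
  have hpc := hp.continuous
  have hqc := hq.continuous
  have hmix : ∀ x, 0 < lam * p x + (1 - lam) * q x := fun x =>
    add_pos (mul_pos hl0 (hppos x)) (mul_pos hm0 (hqpos x))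
  simp only [gradient_const_mul_add_const_mul (hpd _) (hqd _)]
  have hdefect := fun x => norm_sq_div_convexity_defect (gradient p x) (gradient q x)
    hl0 hm0 (hppos x) (hqpos x)
  set D : EuclideanSpace ℝ (Fin n) → ℝ := fun x =>
    lam * (1 - lam) / (p x * q x * (lam * p x + (1 - lam) * q x))
      * ‖q x • gradient p x - p x • gradient q x‖ ^ 2 with hD
  have hcoef : ∀ x, 0 < lam * (1 - lam) / (p x * q x * (lam * p x + (1 - lam) * q x)) :=
    fun x => div_pos (mul_pos hl0 hm0) (mul_pos (mul_pos (hppos x) (hqpos x)) (hmix x))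
  have hDnonneg : ∀ x, 0 ≤ D x := fun x => mul_nonneg (hcoef x).le (sq_nonneg _)
  have hDcont : Continuous D :=
    (Continuous.div (by fun_prop) (by fun_prop)
      fun x => (mul_pos (mul_pos (hppos x) (hqpos x)) (hmix x)).ne').mul (by fun_prop)
  have hsum : Integrable (fun x => lam * (‖gradient p x‖ ^ 2 / p x)
      + (1 - lam) * (‖gradient q x‖ ^ 2 / q x)) :=
    (hJp.const_mul lam).add (hJq.const_mul (1 - lam))
  have hDint : Integrable D := by
    refine hsum.mono' hDcont.aestronglyMeasurable (.of_forall fun x => ?_)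
    rw [Real.norm_of_nonneg (hDnonneg x)]
    have : 0 ≤ ‖lam • gradient p x + (1 - lam) • gradient q x‖ ^ 2
        / (lam * p x + (1 - lam) * q x) := div_nonneg (sq_nonneg _) (hmix x).le
    linarith [hdefect x]
  have hJmix : (∫ x, ‖lam • gradient p x + (1 - lam) • gradient q x‖ ^ 2
        / (lam * p x + (1 - lam) * q x))
      = lam * (∫ x, ‖gradient p x‖ ^ 2 / p x)
        + (1 - lam) * (∫ x, ‖gradient q x‖ ^ 2 / q x) - ∫ x, D x := by
    rw [← integral_const_mul, ← integral_const_mul,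
      ← integral_add (hJp.const_mul lam) (hJq.const_mul (1 - lam)), ← integral_sub hsum hDint]
    exact integral_congr_ae (.of_forall fun x => by linarith [hdefect x])
  rw [hJmix, sub_eq_self, integral_eq_zero_iff_of_nonneg hDnonneg hDint,
    hDcont.ae_eq_iff_eq volume continuous_zero]
  constructor
  · intro h
    obtain ⟨c, hc⟩ := exists_eq_const_mul_of_smul_gradient_eq hpd hqd (fun x => (hqpos x).ne')
      fun x => by
        have hx : D x = 0 := congrFun h x
        simpa [hD, (hcoef x).ne', sub_eq_zero] using
          (mul_eq_zero.mp hx).resolve_left (hcoef x).ne'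
    have hc1 : c = 1 := by
      simpa [hc, integral_const_mul, hqint] using hpint
    simpa [hc1] using hc
  · intro h
    obtain rfl : p = q := funext h
    funext x
    simp [hD]
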